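/- Define u_θ : [0, ∞) → ℝ by u_θ(r) = 18750r⁵ − 9375r⁴ + 1250r³ for 0 ≤ r ≤ 0.2, u_θ(r) = (5r − 2)³(−15r − 6(5r − 1)² + 2) for 0.2 ≤ r ≤ 0.4, and u_θ(r) = 0 for r ≥ 0.4. Then u_θ is well defined and twice continuously differentiable on [0, ∞); in particular, u_θ(0) = 0, and at the matching points the values and the first and second derivatives of the adjacent polynomial pieces coincide: at r = 0.2 both pieces have value 1 and first and second derivatives 0, and at r = 0.4 the middle piece has value 0 and first and second derivatives 0. -/

import Mathlib

theorem hasDerivAt_ite_le {f g f' g' : ℝ → ℝ} {a : ℝ} (hf : ∀ x, HasDerivAt f (f' x) x)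
    (hg : ∀ x, HasDerivAt g (g' x) x) (h0 : f a = g a) (h1 : f' a = g' a) (x : ℝ) :
    HasDerivAt (fun y => if y ≤ a then f y else g y) (if x ≤ a then f' x else g' x) x := by
  rcases lt_trichotomy x a with hx | rfl | hx
  · rw [if_pos hx.le]
    refine (hf x).congr_of_eventuallyEq ?_
    filter_upwards [Iio_mem_nhds hx] with y hy
    exact if_pos (le_of_lt hy)
  · rw [if_pos le_rfl, ← hasDerivWithinAt_univ, ← Set.Iic_union_Ici (a := x)]
    refine HasDerivWithinAt.union ?_ ?_
    · exact (hf x).hasDerivWithinAt.congr (fun y hy => if_pos hy) (if_pos le_rfl)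
    · rw [h1]
      refine (hg x).hasDerivWithinAt.congr (fun y hy => ?_) ((if_pos le_rfl).trans h0)
      rcases (Set.mem_Ici.1 hy).eq_or_lt with rfl | hlt
      · exact (if_pos le_rfl).trans h0
      · exact if_neg hlt.not_ge
  · rw [if_neg hx.not_ge]
    refine (hg x).congr_of_eventuallyEq ?_
    filter_upwards [Ioi_mem_nhds hx] with y hy
    exact if_neg (not_le_of_gt hy)

/-- Two functions of class `C^n` whose derivatives up to order `n` agree at `a` glue at `a` to a
function of class `C^n`. -/
theorem contDiff_ite_le {n : ℕ} {f g : ℝ → ℝ} {a : ℝ} (hf : ContDiff ℝ n f) (hg : ContDiff ℝ n g)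
    (h : ∀ k ≤ n, iteratedDeriv k f a = iteratedDeriv k g a) :
    ContDiff ℝ n (fun x => if x ≤ a then f x else g x) := by
  have h0 : f a = g a := by simpa using h 0 (Nat.zero_le _)
  induction n generalizing f g with
  | zero =>
    simp only [Nat.cast_zero, contDiff_zero] at *
    exact hf.if_le hg continuous_id continuous_const (by rintro x rfl; exact h0)
  | succ n ih =>
    have h1 : deriv f a = deriv g a := by simpa using h 1 (by omega)
    push_cast at hf hg ⊢
    rw [contDiff_succ_iff_deriv] at hf hg ⊢
    have key := hasDerivAt_ite_le (fun x => (hf.1 x).hasDerivAt) (fun x => (hg.1 x).hasDerivAt)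
      h0 h1
    refine ⟨fun x => (key x).differentiableAt, by simp, ?_⟩
    rw [funext fun x => (key x).deriv]
    refine ih hf.2.2 hg.2.2 (fun k hk => ?_) h1
    simpa [iteratedDeriv_succ'] using h (k + 1) (by omega)

theorem deriv_quintic (a b c d e f : ℝ) :
    deriv (fun r : ℝ => a * r ^ 5 + b * r ^ 4 + c * r ^ 3 + d * r ^ 2 + e * r + f) =
      fun r => 0 * r ^ 5 + 5 * a * r ^ 4 + 4 * b * r ^ 3 + 3 * c * r ^ 2 + 2 * d * r + e := by
  funext r
  have h := ((((((hasDerivAt_pow 5 r).const_mul a).add ((hasDerivAt_pow 4 r).const_mul b)).add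
    ((hasDerivAt_pow 3 r).const_mul c)).add ((hasDerivAt_pow 2 r).const_mul d)).add
    ((hasDerivAt_id r).const_mul e)).add_const f
  refine (h.congr_deriv ?_).deriv
  push_cast
  ring

theorem c2_gresho_angular_velocity_is_C2
    (uθ q1 q2 : ℝ → ℝ)
    (hq1 : ∀ r : ℝ, q1 r = 18750 * r ^ 5 - 9375 * r ^ 4 + 1250 * r ^ 3)
    (hq2 : ∀ r : ℝ, q2 r = (5 * r - 2) ^ 3 * (-15 * r - 6 * (5 * r - 1) ^ 2 + 2))
    (huθ : ∀ r : ℝ, uθ r = if r ≤ 0.2 then q1 r else if r ≤ 0.4 then q2 r else 0) :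
    uθ 0 = 0
    ∧ q1 0.2 = 1 ∧ q2 0.2 = 1
    ∧ deriv q1 0.2 = 0 ∧ deriv q2 0.2 = 0
    ∧ deriv (deriv q1) 0.2 = 0 ∧ deriv (deriv q2) 0.2 = 0
    ∧ q2 0.4 = 0 ∧ deriv q2 0.4 = 0 ∧ deriv (deriv q2) 0.4 = 0
    ∧ ContDiffOn ℝ 2 uθ (Set.Ici 0) := by
  have e1 : q1 = fun r => 18750 * r ^ 5 + (-9375) * r ^ 4 + 1250 * r ^ 3 + 0 * r ^ 2 + 0 * r + 0 := by
    funext r; rw [hq1]; ring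
  have e2 : q2 = fun r => (-18750) * r ^ 5 + 28125 * r ^ 4 + (-16250) * r ^ 3 + 4500 * r ^ 2
      + (-600) * r + 32 := by
    funext r; rw [hq2]; ring
  have v1 : q1 0.2 = 1 := by rw [hq1]; norm_num
  have v2 : q2 0.2 = 1 := by rw [hq2]; norm_num
  have v3 : q2 0.4 = 0 := by rw [hq2]; norm_num
  have d1 : deriv q1 0.2 = 0 := by rw [e1, deriv_quintic]; norm_num
  have d2 : deriv q2 0.2 = 0 := by rw [e2, deriv_quintic]; norm_num
  have d3 : deriv q2 0.4 = 0 := by rw [e2, deriv_quintic]; norm_num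
  have s1 : deriv (deriv q1) 0.2 = 0 := by rw [e1, deriv_quintic, deriv_quintic]; norm_num
  have s2 : deriv (deriv q2) 0.2 = 0 := by rw [e2, deriv_quintic, deriv_quintic]; norm_num
  have s3 : deriv (deriv q2) 0.4 = 0 := by rw [e2, deriv_quintic, deriv_quintic]; norm_num
  have c1 : ContDiff ℝ (2 : ℕ) q1 := by rw [e1]; fun_prop
  have c2 : ContDiff ℝ (2 : ℕ) q2 := by rw [e2]; fun_prop
  have outer : ContDiff ℝ (2 : ℕ) (fun r : ℝ => if r ≤ 0.4 then q2 r else 0) := by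
    refine contDiff_ite_le c2 contDiff_const fun k hk => ?_
    interval_cases k <;> simp [iteratedDeriv_succ, v3, d3, s3]
  have local_eq : (fun r : ℝ => if r ≤ 0.4 then q2 r else 0) =ᶠ[nhds 0.2] q2 := by
    filter_upwards [Iio_mem_nhds (show (0.2 : ℝ) < 0.4 by norm_num)] with r hr
    exact if_pos (le_of_lt hr)
  refine ⟨?_, v1, v2, d1, d2, s1, s2, v3, d3, s3, ?_⟩
  · rw [huθ, if_pos (by norm_num), hq1]
    norm_num
  · rw [funext huθ]
    refine (contDiff_ite_le c1 outer fun k hk => ?_).contDiffOn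
    rw [local_eq.iteratedDeriv_eq]
    interval_cases k <;> simp [iteratedDeriv_succ, v1, v2, d1, d2, s1, s2]
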